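/- Given P partitions each to be assigned to ρ_N distinct nodes spanning at least ρ_Z distinct zones, with node n storing at most ⌊c_n/s⌋ partitions: such an assignment α exists if and only if the maximum flow in the graph G(s) equals ρ_N · P. Moreover assignments α correspond exactly to maximal flows f of value ρ_N·P via: the unit-capacity arc x_{p,z}→n is saturated in f if and only if node n (of zone z) is one of the ρ_N nodes assigned to partition p. -/

import Mathlib

inductive Vert (P Z N : Type) where
  | src | snk
  | pp (p : P) | pm (p : P)
  | x (p : P) (z : Z)
  | node (n : N)
  deriving DecidableEq, Fintype

variable {P Z N : Type} [Fintype P] [Fintype Z] [Fintype N]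
  [DecidableEq P] [DecidableEq Z] [DecidableEq N]

/-- Capacities of the assignment flow graph `G(s)`. -/
def cap (zone : N → Z) (c : N → ℕ) (rN rZ s : ℕ) :
    Vert P Z N → Vert P Z N → ℕ
  | .src, .pp _ => rZ
  | .src, .pm _ => rN - rZ
  | .pp p, .x q _ => if p = q then 1 else 0
  | .pm p, .x q _ => if p = q then rN - rZ else 0
  | .x _ z, .node n => if zone n = z then 1 else 0
  | .node n, .snk => c n / s
  | _, _ => 0

/-- An integral flow on the graph with capacity function `k`. -/
def IsNFlow (k f : Vert P Z N → Vert P Z N → ℕ) : Prop :=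
  (∀ u v, f u v ≤ k u v) ∧
    ∀ v, v ≠ Vert.src → v ≠ Vert.snk → ∑ u, f u v = ∑ u, f v u

/-- The value of a flow: total flow leaving the source. -/
def flowValue (f : Vert P Z N → Vert P Z N → ℕ) : ℕ := ∑ v, f Vert.src v

/-- A valid assignment: each partition gets exactly `ρ_N` distinct nodes spanning at
least `ρ_Z` zones, and node `n` stores at most `⌊c_n / s⌋` partitions. -/
def IsAssignment (zone : N → Z) (c : N → ℕ) (rN rZ s : ℕ) (a : P → Finset N) : Prop :=
  (∀ p, (a p).card = rN) ∧ (∀ p, rZ ≤ ((a p).image zone).card) ∧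
    ∀ n, (Finset.univ.filter fun p => n ∈ a p).card ≤ c n / s

def vertEquiv : Vert P Z N ≃ Unit ⊕ Unit ⊕ P ⊕ P ⊕ (P × Z) ⊕ N where
  toFun
    | .src => .inl ()
    | .snk => .inr (.inl ())
    | .pp p => .inr (.inr (.inl p))
    | .pm p => .inr (.inr (.inr (.inl p)))
    | .x p z => .inr (.inr (.inr (.inr (.inl (p, z)))))
    | .node n => .inr (.inr (.inr (.inr (.inr n))))
  invFun
    | .inl _ => .src
    | .inr (.inl _) => .snk
    | .inr (.inr (.inl p)) => .pp p
    | .inr (.inr (.inr (.inl p))) => .pm p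
    | .inr (.inr (.inr (.inr (.inl (p, z))))) => .x p z
    | .inr (.inr (.inr (.inr (.inr n)))) => .node n
  left_inv v := by cases v <;> rfl
  right_inv v := by rcases v with _ | _ | _ | _ | _ | _ <;> rfl

theorem vert_sum (g : Vert P Z N → ℕ) :
    ∑ v, g v = g .src + (g .snk + (∑ p, g (.pp p) + (∑ p, g (.pm p) +
      (∑ p, ∑ z, g (.x p z) + ∑ n, g (.node n))))) := by
  rw [← Equiv.sum_comp (vertEquiv (P := P) (Z := Z) (N := N)).symm g]
  simp [Fintype.sum_sum_type, Fintype.sum_prod_type, vertEquiv]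

def mkf (zone : N → Z) (A B : P → ℕ) (C D : P → Z → ℕ) (E : P → N → ℕ) (F : N → ℕ) :
    Vert P Z N → Vert P Z N → ℕ
  | .src, .pp p => A p
  | .src, .pm p => B p
  | .pp p, .x q z => if p = q then C q z else 0
  | .pm p, .x q z => if p = q then D q z else 0
  | .x p z, .node n => if zone n = z then E p n else 0
  | .node n, .snk => F n
  | _, _ => 0

theorem eq_mkf (zone : N → Z) (c : N → ℕ) (rN rZ s : ℕ) (f : Vert P Z N → Vert P Z N → ℕ)
    (hf : ∀ u v, f u v ≤ cap zone c rN rZ s u v) :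
    f = mkf zone (fun p => f .src (.pp p)) (fun p => f .src (.pm p))
      (fun p z => f (.pp p) (.x p z)) (fun p z => f (.pm p) (.x p z))
      (fun p n => f (.x p (zone n)) (.node n)) (fun n => f (.node n) .snk) := by
  funext u v
  have h := hf u v
  cases u <;> cases v <;> simp only [cap, mkf] at h ⊢ <;> first | omega | skip
  all_goals split_ifs at h ⊢ with e <;> first | (subst e; rfl) | omega

theorem row_sum (C : P → Z → ℕ) (p : P) :
    (∑ q, ∑ z, if p = q then C q z else 0) = ∑ z, C p z := by
  rw [Finset.sum_comm]
  simp

theorem flow_mkf (zone : N → Z) (c : N → ℕ) (rN rZ s : ℕ)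
    (A B : P → ℕ) (C D : P → Z → ℕ) (E : P → N → ℕ) (F : N → ℕ) :
    IsNFlow (cap zone c rN rZ s) (mkf zone A B C D E F) ↔
      ((∀ p, A p ≤ rZ) ∧ (∀ p, B p ≤ rN - rZ) ∧ (∀ p z, C p z ≤ 1) ∧
        (∀ p z, D p z ≤ rN - rZ) ∧ (∀ p n, E p n ≤ 1) ∧ (∀ n, F n ≤ c n / s)) ∧
      (∀ p, A p = ∑ z, C p z) ∧ (∀ p, B p = ∑ z, D p z) ∧
      (∀ p z, C p z + D p z = ∑ n, if zone n = z then E p n else 0) ∧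
      (∀ n, ∑ p, E p n = F n) := by
  constructor
  · rintro ⟨hc, hb⟩
    refine ⟨⟨fun p => hc .src (.pp p), fun p => hc .src (.pm p),
      fun p z => by simpa [cap, mkf] using hc (.pp p) (.x p z),
      fun p z => by simpa [cap, mkf] using hc (.pm p) (.x p z),
      fun p n => by simpa [cap, mkf] using hc (.x p (zone n)) (.node n),
      fun n => hc (.node n) .snk⟩, fun p => ?_, fun p => ?_, fun p z => ?_, fun n => ?_⟩
    · have := hb (.pp p) (by simp) (by simp)
      rw [vert_sum, vert_sum] at this
      simp only [mkf] at this
      rw [row_sum] at this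
      simpa using this
    · have := hb (.pm p) (by simp) (by simp)
      rw [vert_sum, vert_sum] at this
      simp only [mkf] at this
      rw [row_sum] at this
      simpa using this
    · have := hb (.x p z) (by simp) (by simp)
      rw [vert_sum, vert_sum] at this
      simpa [mkf] using this
    · have := hb (.node n) (by simp) (by simp)
      rw [vert_sum, vert_sum] at this
      simpa [mkf] using this
  · rintro ⟨⟨hA, hB, hC, hD, hE, hF⟩, h1, h2, h3, h4⟩
    refine ⟨fun u v => ?_, fun v hv hv' => ?_⟩
    · cases u <;> cases v <;> simp only [cap, mkf] <;> try split_ifs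
      all_goals first | exact le_rfl | apply_assumption
    · rw [vert_sum, vert_sum]
      cases v with
      | src => exact absurd rfl hv
      | snk => exact absurd rfl hv'
      | pp p =>
        simp only [mkf]
        rw [row_sum]
        simpa using h1 p
      | pm p =>
        simp only [mkf]
        rw [row_sum]
        simpa using h2 p
      | x p z => simpa [mkf] using h3 p z
      | node n => simpa [mkf] using h4 n

theorem value_mkf (zone : N → Z)
    (A B : P → ℕ) (C D : P → Z → ℕ) (E : P → N → ℕ) (F : N → ℕ) :
    flowValue (mkf zone A B C D E F) = ∑ p, A p + ∑ p, B p := by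
  rw [flowValue, vert_sum]
  simp [mkf]

theorem zone_sum (zone : N → Z) (e : N → ℕ) :
    ∑ z, (∑ n, if zone n = z then e n else 0) = ∑ n, e n := by
  rw [Finset.sum_comm]
  simp

/-- `α` is a valid assignment iff there is a flow of value `ρ_N · P` in
`G(s)` whose saturated unit arcs `x_{p,z} → n` are exactly the partition-node
associations of `α`. -/
theorem stmt6 (zone : N → Z) (c : N → ℕ) (rN rZ s : ℕ)
    (hs : 0 < s) (h1 : 1 ≤ rZ) (h2 : rZ ≤ rN) (a : P → Finset N) :
    IsAssignment zone c rN rZ s a ↔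
      ∃ f : Vert P Z N → Vert P Z N → ℕ,
        IsNFlow (cap zone c rN rZ s) f ∧
        flowValue f = rN * Fintype.card P ∧
        ∀ (p : P) (n : N), f (Vert.x p (zone n)) (Vert.node n) = 1 ↔ n ∈ a p := by
  constructor
  · rintro ⟨ha, hz, hn⟩
    choose T hT hTc using fun p => Finset.exists_subset_card_eq (hz p)
    let E : P → N → ℕ := fun p n => if n ∈ a p then 1 else 0
    let K : P → Z → ℕ := fun p z => ∑ n, if zone n = z then E p n else 0
    let C : P → Z → ℕ := fun p z => if z ∈ T p then 1 else 0
    have hCK : ∀ p z, C p z ≤ K p z := by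
      intro p z
      by_cases h : z ∈ T p
      · obtain ⟨n, hn, rfl⟩ := Finset.mem_image.1 (hT p h)
        have := Finset.single_le_sum (f := fun m => if zone m = zone n then E p m else 0)
          (fun _ _ => Nat.zero_le _) (Finset.mem_univ n)
        simpa [C, K, E, h, hn] using this
      · simp [C, h]
    have hKs : ∀ p, ∑ z, K p z = rN := by
      intro p
      rw [← ha p]
      simp only [K]
      rw [zone_sum]
      simp [E]
    have hCs : ∀ p, ∑ z, C p z = rZ := by
      intro p
      simp [C, hTc]
    have hDs : ∀ p, ∑ z, (K p z - C p z) = rN - rZ := by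
      intro p
      rw [Finset.sum_tsub_distrib _ (fun z _ => hCK p z), hKs, hCs]
    refine ⟨mkf zone (fun _ => rZ) (fun _ => rN - rZ) C (fun p z => K p z - C p z) E
      (fun n => ∑ p, E p n), ?_, ?_, ?_⟩
    · rw [flow_mkf]
      refine ⟨⟨fun _ => le_rfl, fun _ => le_rfl, fun p z => ?_, fun p z => ?_, fun p n => ?_,
        fun n => ?_⟩, fun p => (hCs p).symm, fun p => (hDs p).symm, fun p z => ?_, fun n => rfl⟩
      · simp only [C]; split_ifs <;> simp
      · rw [← hDs p]
        exact Finset.single_le_sum (f := fun z => K p z - C p z)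
          (fun _ _ => Nat.zero_le _) (Finset.mem_univ z)
      · simp only [E]; split_ifs <;> simp
      · simpa [E] using hn n
      · exact Nat.add_sub_cancel' (hCK p z)
    · rw [value_mkf]
      simp only [Finset.sum_const, Finset.card_univ, smul_eq_mul]
      rw [← mul_add, Nat.add_sub_cancel' h2, mul_comm]
    · intro p n
      simp [mkf, E]
  · rintro ⟨f, hf, hv, hfa⟩
    have he := eq_mkf zone c rN rZ s f hf.1
    generalize (fun p => f .src (.pp p)) = A at he
    generalize (fun p => f .src (.pm p)) = B at he
    generalize (fun p z => f (.pp p) (.x p z)) = C at he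
    generalize (fun p z => f (.pm p) (.x p z)) = D at he
    generalize (fun p n => f (.x p (zone n)) (.node n)) = E at he
    generalize (fun n => f (.node n) .snk) = F at he
    subst he
    rw [value_mkf, ← Finset.sum_add_distrib] at hv
    rw [flow_mkf] at hf
    obtain ⟨⟨hA, hB, hC, hD, hE, hF⟩, q1, q2, q3, q4⟩ := hf
    simp only [mkf, if_true] at hfa
    have hEa : ∀ p n, E p n = if n ∈ a p then 1 else 0 := by
      intro p n
      have := hE p n
      split_ifs with h
      · exact (hfa p n).2 h
      · have := mt (hfa p n).1 h
        omega
    have hAB : ∀ p, A p + B p = rN := by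
      have hle : ∀ p ∈ (Finset.univ : Finset P), A p + B p ≤ rN := by
        intro p _
        have := hA p
        have := hB p
        omega
      have := (Finset.sum_eq_sum_iff_of_le hle).1 (by rw [hv]; simp [mul_comm])
      exact fun p => this p (Finset.mem_univ p)
    refine ⟨fun p => ?_, fun p => ?_, fun n => ?_⟩
    · rw [← hAB p, q1, q2, ← Finset.sum_add_distrib, Finset.sum_congr rfl fun z _ => q3 p z,
        zone_sum]
      simp [hEa]
    · have hAp : A p = rZ := by
        have := hA p
        have := hB p
        have := hAB p
        omega
      rw [← hAp, q1, Finset.card_eq_sum_ones, ← Finset.sum_filter_add_sum_filter_not Finset.univ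
        (fun z => z ∈ (a p).image zone)]
      have h0 : ∑ z ∈ Finset.univ.filter (fun z => ¬ z ∈ (a p).image zone), C p z = 0 := by
        refine Finset.sum_eq_zero fun z hz => ?_
        have hz' : ∀ n ∈ a p, zone n ≠ z := by simpa using hz
        have h3 := q3 p z
        have : (∑ n, if zone n = z then E p n else 0) = 0 := by
          refine Finset.sum_eq_zero fun n _ => ?_
          split_ifs with h
          · rw [hEa, if_neg fun hn => hz' n hn h]
          · rfl
        omega
      rw [h0, add_zero, Finset.filter_univ_mem]
      exact Finset.sum_le_sum fun z _ => hC p z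
    · refine le_trans (le_of_eq ?_) (hF n)
      rw [← q4]
      simp [hEa]
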